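/- arXiv:math/0410065 — 2 statements merged into one kernel-verified Lean document; each statement's English description precedes it below -/
import Mathlib

section
/- Let V be an n-dimensional real inner product space with orthonormal basis (e_1, …, e_n) and let 1 ≤ p ≤ n−1. Then V⊗Λ^pV is the internal direct sum of the three subspaces im j₋, im j₊ and Λ^{p,1}V := ker w ∩ ker c; equivalently, the linear map Φ : Λ^{p−1}V × Λ^{p+1}V × Λ^{p,1}V → V⊗Λ^pV given by Φ(α, η, τ) = j₋(α) + j₊(η) + τ is a linear isomorphism. Moreover w∘j₊ = (p+1)·id on Λ^{p+1}V, c∘j₋ = (n−p+1)·id on Λ^{p−1}V, w∘j₋ = 0 and c∘j₊ = 0. -/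
open TensorProduct

theorem euler_aux {V : Type*} [NormedAddCommGroup V] [InnerProductSpace ℝ V]
    {n : ℕ} (e : OrthonormalBasis (Fin n) ℝ V) (k : ℕ) (x : ExteriorAlgebra ℝ V)
    (hx : x ∈ ⋀[ℝ]^k V) :
    ∑ i, ExteriorAlgebra.ι ℝ (e i) * CliffordAlgebra.contractLeft (Q := (0 : QuadraticForm ℝ V))
      (innerₛₗ ℝ (e i)) x = (k : ℝ) • x := by
  induction hx using Submodule.pow_induction_on_left' with
  | algebraMap r =>
    simp only [Nat.cast_zero, zero_smul]
    refine Finset.sum_eq_zero fun i _ => ?_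
    erw [CliffordAlgebra.contractLeft_algebraMap]
    exact mul_zero _
  | add x y i hx hy ihx ihy =>
    rw [smul_add, ← ihx, ← ihy, ← Finset.sum_add_distrib]
    refine Finset.sum_congr rfl fun j _ => ?_
    rw [← mul_add]
    exact congrArg _ (map_add _ x y)
  | mem_mul m hm i y hy ih =>
    obtain ⟨v, rfl⟩ := hm
    have key : ∀ j, ExteriorAlgebra.ι ℝ (e j) *
        CliffordAlgebra.contractLeft (Q := (0 : QuadraticForm ℝ V))
          (innerₛₗ ℝ (e j)) (ExteriorAlgebra.ι ℝ v * y) =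
        ExteriorAlgebra.ι ℝ (inner ℝ (e j) v • e j) * y +
        ExteriorAlgebra.ι ℝ v * (ExteriorAlgebra.ι ℝ (e j) *
          CliffordAlgebra.contractLeft (Q := (0 : QuadraticForm ℝ V)) (innerₛₗ ℝ (e j)) y) := by
      intro j
      have h1 : CliffordAlgebra.contractLeft (Q := (0 : QuadraticForm ℝ V))
          (innerₛₗ ℝ (e j)) (ExteriorAlgebra.ι ℝ v * y) = inner ℝ (e j) v • y -
          ExteriorAlgebra.ι ℝ v *
            CliffordAlgebra.contractLeft (Q := (0 : QuadraticForm ℝ V)) (innerₛₗ ℝ (e j)) y :=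
        CliffordAlgebra.contractLeft_ι_mul _ _ _
      have h2 : ExteriorAlgebra.ι ℝ (e j) * ExteriorAlgebra.ι ℝ v =
          - (ExteriorAlgebra.ι ℝ v * ExteriorAlgebra.ι ℝ (e j)) :=
        eq_neg_of_add_eq_zero_left (ExteriorAlgebra.ι_add_mul_swap _ _)
      rw [h1, mul_sub, ← mul_assoc, h2, map_smul, neg_mul, sub_neg_eq_add, mul_assoc,
        smul_mul_assoc, mul_smul_comm]
    rw [Finset.sum_congr rfl fun j _ => key j, Finset.sum_add_distrib, ← Finset.mul_sum, ih,
      ← Finset.sum_mul, ← map_sum, e.sum_repr' v, mul_smul_comm, Nat.cast_succ, add_smul, one_smul,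
      add_comm]

/-- **Decomposition of `V ⊗ ΛᵖV`.**
Let `V` be an `n`-dimensional real inner product space with orthonormal basis
`(e i)` and let `p = q + 1` with `1 ≤ p ≤ n - 1`.  Here `Wdg k v` is exterior
multiplication `v ∧ · : ΛᵏV → Λᵏ⁺¹V` and `Ctr k v` is the interior product
`v ⌟ · : Λᵏ⁺¹V → ΛᵏV` determined by the inner product; `w`, `c` are the induced
wedge and contraction maps on `V ⊗ ΛᵖV`, and `j₊(η) = ∑ i, e i ⊗ (e i ⌟ η)`,
`j₋(α) = ∑ i, e i ⊗ (e i ∧ α)`.  Then `V ⊗ ΛᵖV` is the internal direct sum of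
`im j₋`, `im j₊` and `Λ^{p,1}V = ker w ∩ ker c`, i.e. the map
`Φ(α, η, τ) = j₋ α + j₊ η + τ` is a linear isomorphism
`Λ^{p-1}V × Λ^{p+1}V × Λ^{p,1}V ≅ V ⊗ ΛᵖV`.  Moreover
`w ∘ j₊ = (p+1)·id`, `c ∘ j₋ = (n-p+1)·id`, `w ∘ j₋ = 0` and `c ∘ j₊ = 0`. -/
theorem tensor_form_space_decomposition
    {V : Type*} [NormedAddCommGroup V] [InnerProductSpace ℝ V]
    [FiniteDimensional ℝ V]
    {n : ℕ} (e : OrthonormalBasis (Fin n) ℝ V)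
    (q : ℕ) (hp : q + 1 ≤ n - 1)
    (Wdg : ∀ k : ℕ, V →ₗ[ℝ] ↥(⋀[ℝ]^k V) →ₗ[ℝ] ↥(⋀[ℝ]^(k+1) V))
    (hWdg : ∀ (k : ℕ) (v : V) (ω : ⋀[ℝ]^k V),
      ((Wdg k v ω : ⋀[ℝ]^(k+1) V) : ExteriorAlgebra ℝ V) =
        ExteriorAlgebra.ι ℝ v * (ω : ExteriorAlgebra ℝ V))
    (Ctr : ∀ k : ℕ, V →ₗ[ℝ] ↥(⋀[ℝ]^(k+1) V) →ₗ[ℝ] ↥(⋀[ℝ]^k V))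
    (hCtr : ∀ (k : ℕ) (v : V) (ω : ⋀[ℝ]^(k+1) V),
      ((Ctr k v ω : ⋀[ℝ]^k V) : ExteriorAlgebra ℝ V) =
        CliffordAlgebra.contractLeft (Q := (0 : QuadraticForm ℝ V))
          (innerₛₗ ℝ v) (ω : ExteriorAlgebra ℝ V))
    (w : V ⊗[ℝ] ↥(⋀[ℝ]^(q+1) V) →ₗ[ℝ] ↥(⋀[ℝ]^(q+2) V))
    (hw : w = TensorProduct.lift (Wdg (q+1)))
    (c : V ⊗[ℝ] ↥(⋀[ℝ]^(q+1) V) →ₗ[ℝ] ↥(⋀[ℝ]^q V))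
    (hc : c = TensorProduct.lift (Ctr q))
    (jminus : ↥(⋀[ℝ]^q V) →ₗ[ℝ] V ⊗[ℝ] ↥(⋀[ℝ]^(q+1) V))
    (hjminus : jminus =
      ∑ i, (TensorProduct.mk ℝ V ↥(⋀[ℝ]^(q+1) V) (e i)) ∘ₗ (Wdg q (e i)))
    (jplus : ↥(⋀[ℝ]^(q+2) V) →ₗ[ℝ] V ⊗[ℝ] ↥(⋀[ℝ]^(q+1) V))
    (hjplus : jplus =
      ∑ i, (TensorProduct.mk ℝ V ↥(⋀[ℝ]^(q+1) V) (e i)) ∘ₗ (Ctr (q+1) (e i))) :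
    Function.Bijective
      (fun x : ↥(⋀[ℝ]^q V) × ↥(⋀[ℝ]^(q+2) V) ×
          ↥(LinearMap.ker w ⊓ LinearMap.ker c) =>
        jminus x.1 + jplus x.2.1 + (x.2.2 : V ⊗[ℝ] ↥(⋀[ℝ]^(q+1) V))) ∧
    (∀ η : ⋀[ℝ]^(q+2) V, w (jplus η) = (((q : ℝ) + 1) + 1) • η) ∧
    (∀ α : ⋀[ℝ]^q V, c (jminus α) = ((n : ℝ) - ((q : ℝ) + 1) + 1) • α) ∧
    (∀ α : ⋀[ℝ]^q V, w (jminus α) = 0) ∧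
    (∀ η : ⋀[ℝ]^(q+2) V, c (jplus η) = 0) := by
  have W : ∀ η : ⋀[ℝ]^(q+2) V, w (jplus η) = (((q : ℝ) + 1) + 1) • η := by
    intro η
    apply Subtype.ext
    subst hw hjplus
    have := euler_aux e (q+2) η η.2
    simp only [LinearMap.sum_apply, map_sum, LinearMap.comp_apply, TensorProduct.mk_apply,
      TensorProduct.lift.tmul, AddSubmonoidClass.coe_finsetSum, hWdg, hCtr, Submodule.coe_smul]
    rw [this]
    push_cast
    congr 1
    ring
  have C : ∀ α : ⋀[ℝ]^q V, c (jminus α) = ((n : ℝ) - ((q : ℝ) + 1) + 1) • α := by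
    intro α
    apply Subtype.ext
    subst hc hjminus
    have h := euler_aux e q α α.2
    simp only [LinearMap.sum_apply, map_sum, LinearMap.comp_apply, TensorProduct.mk_apply,
      TensorProduct.lift.tmul, AddSubmonoidClass.coe_finsetSum, hWdg, hCtr, Submodule.coe_smul]
    have h1 : ∀ j, CliffordAlgebra.contractLeft (Q := (0 : QuadraticForm ℝ V))
          (innerₛₗ ℝ (e j)) (ExteriorAlgebra.ι ℝ (e j) * (α : ExteriorAlgebra ℝ V)) =
          (α : ExteriorAlgebra ℝ V) - ExteriorAlgebra.ι ℝ (e j) *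
            CliffordAlgebra.contractLeft (Q := (0 : QuadraticForm ℝ V)) (innerₛₗ ℝ (e j))
              (α : ExteriorAlgebra ℝ V) := by
      intro j
      refine (CliffordAlgebra.contractLeft_ι_mul _ _ _).trans ?_
      have : innerₛₗ ℝ (e j) (e j) = (1 : ℝ) := by simp
      rw [this, one_smul]
    refine (Finset.sum_congr rfl fun j _ => h1 j).trans ?_
    rw [Finset.sum_sub_distrib, h, Finset.sum_const, Finset.card_univ, Fintype.card_fin,
      ← Nat.cast_smul_eq_nsmul ℝ, ← sub_smul]
    congr 1
    ring
  have W0 : ∀ α : ⋀[ℝ]^q V, w (jminus α) = 0 := by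
    intro α
    apply Subtype.ext
    subst hw hjminus
    simp only [LinearMap.sum_apply, map_sum, LinearMap.comp_apply, TensorProduct.mk_apply,
      TensorProduct.lift.tmul, AddSubmonoidClass.coe_finsetSum, hWdg, hCtr]
    refine Finset.sum_eq_zero fun i _ => ?_
    rw [← mul_assoc, ExteriorAlgebra.ι_sq_zero, zero_mul]
  have C0 : ∀ η : ⋀[ℝ]^(q+2) V, c (jplus η) = 0 := by
    intro α
    apply Subtype.ext
    subst hc hjplus
    simp only [LinearMap.sum_apply, map_sum, LinearMap.comp_apply, TensorProduct.mk_apply,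
      TensorProduct.lift.tmul, AddSubmonoidClass.coe_finsetSum, hWdg, hCtr]
    refine Finset.sum_eq_zero fun i _ => ?_
    exact CliffordAlgebra.contractLeft_contractLeft _ _
  refine ⟨?_, W, C, W0, C0⟩
  have ha : ((q : ℝ) + 1) + 1 ≠ 0 := by positivity
  have hb : (n : ℝ) - ((q : ℝ) + 1) + 1 ≠ 0 := by
    have : q + 2 ≤ n := by omega
    have : (q : ℝ) + 2 ≤ n := by exact_mod_cast this
    intro h
    linarith
  constructor
  · rintro ⟨α, η, τ, hτ⟩ ⟨α', η', τ', hτ'⟩ h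
    simp only [Submodule.mem_inf, LinearMap.mem_ker] at hτ hτ'
    simp only at h
    have h1 := congrArg c h
    have h2 := congrArg w h
    simp only [map_add, W, C, W0, C0, hτ.1, hτ.2, hτ'.1, hτ'.2, add_zero, zero_add] at h1 h2
    have e1 : α = α' := smul_right_injective _ hb h1
    have e2 : η = η' := smul_right_injective _ ha h2
    subst e1 e2
    have e3 : τ = τ' := add_left_cancel h
    subst e3
    rfl
  · intro t
    refine ⟨⟨((n : ℝ) - ((q : ℝ) + 1) + 1)⁻¹ • c t, (((q : ℝ) + 1) + 1)⁻¹ • w t,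
      t - jminus (((n : ℝ) - ((q : ℝ) + 1) + 1)⁻¹ • c t) -
        jplus ((((q : ℝ) + 1) + 1)⁻¹ • w t), ?_⟩, ?_⟩
    · simp only [Submodule.mem_inf, LinearMap.mem_ker]
      constructor
      · rw [map_sub, map_sub, W0, W, smul_inv_smul₀ ha]
        abel
      · rw [map_sub, map_sub, C0, C, smul_inv_smul₀ hb]
        abel
    · simp only
      abel
end

section
/- Let V be an n-dimensional real inner product space with orthonormal basis (e_1, …, e_n) and let 1 ≤ p ≤ n−1. For τ = Σ_i e_i⊗τ_i ∈ V⊗Λ^pV (with τ_i ∈ Λ^pV), define P(τ) := Σ_i e_i⊗( τ_i − (1/(p+1))·(e_i⌟w(τ)) − (1/(n−p+1))·(e_i∧c(τ)) ). Then P(τ) ∈ Λ^{p,1}V and τ − P(τ) ∈ im j₋ + im j₊; that is, P is the projection of V⊗Λ^pV onto Λ^{p,1}V along the complement im j₋ ⊕ im j₊. (This is the algebraic form of the twistor operator: its value on X is τ(X) minus 1/(p+1) times the contraction of X into the wedge part of τ minus 1/(n−p+1) times X wedged with the contraction part of τ.) -/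
open TensorProduct

lemma number_op {V : Type*} [NormedAddCommGroup V] [InnerProductSpace ℝ V]
    {n : ℕ} (e : OrthonormalBasis (Fin n) ℝ V) (k : ℕ) (x : ExteriorAlgebra ℝ V)
    (hx : x ∈ ⋀[ℝ]^k V) :
    ∑ i, ExteriorAlgebra.ι ℝ (e i) *
      (CliffordAlgebra.contractLeft (Q := (0 : QuadraticForm ℝ V)) (innerₛₗ ℝ (e i)) x :
        ExteriorAlgebra ℝ V) = (k : ℝ) • x := by
  induction hx using Submodule.pow_induction_on_left' with
  | algebraMap r =>
    simp [CliffordAlgebra.contractLeft_algebraMap]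
  | add x y i hx hy ihx ihy =>
    rw [smul_add, ← ihx, ← ihy, ← Finset.sum_add_distrib]
    refine Finset.sum_congr rfl fun i _ => ?_
    rw [← mul_add]
    exact congrArg _ (map_add _ _ _)
  | mem_mul m hm i x hx ih =>
    obtain ⟨v, rfl⟩ := hm
    have key : ∀ j, ExteriorAlgebra.ι ℝ (e j) *
        (CliffordAlgebra.contractLeft (Q := (0 : QuadraticForm ℝ V)) (innerₛₗ ℝ (e j))
          (ExteriorAlgebra.ι ℝ v * x) : ExteriorAlgebra ℝ V) =
        ExteriorAlgebra.ι ℝ (inner ℝ (e j) v • e j) * x + ExteriorAlgebra.ι ℝ v *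
          (ExteriorAlgebra.ι ℝ (e j) *
          (CliffordAlgebra.contractLeft (Q := (0 : QuadraticForm ℝ V)) (innerₛₗ ℝ (e j)) x :
            ExteriorAlgebra ℝ V)) := by
      intro j
      have h1 : (CliffordAlgebra.contractLeft (Q := (0 : QuadraticForm ℝ V)) (innerₛₗ ℝ (e j))
          (ExteriorAlgebra.ι ℝ v * x) : ExteriorAlgebra ℝ V) =
          (inner ℝ (e j) v : ℝ) • x - ExteriorAlgebra.ι ℝ v *
          (CliffordAlgebra.contractLeft (Q := (0 : QuadraticForm ℝ V)) (innerₛₗ ℝ (e j)) x :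
            ExteriorAlgebra ℝ V) :=
        CliffordAlgebra.contractLeft_ι_mul (Q := (0 : QuadraticForm ℝ V)) _ v _
      have h2 : ExteriorAlgebra.ι ℝ (e j) * ExteriorAlgebra.ι ℝ v =
          - (ExteriorAlgebra.ι ℝ v * ExteriorAlgebra.ι ℝ (e j)) :=
        eq_neg_of_add_eq_zero_left (ExteriorAlgebra.ι_add_mul_swap _ _)
      rw [h1, mul_sub, ← mul_assoc, h2, map_smul, mul_smul_comm, smul_mul_assoc, neg_mul,
        sub_neg_eq_add, mul_assoc]
    rw [Finset.sum_congr rfl fun j _ => key j, Finset.sum_add_distrib, ← Finset.mul_sum, ih,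
      ← Finset.sum_mul, ← map_sum, e.sum_repr' v, mul_smul_comm]
    push_cast
    rw [add_smul, one_smul, add_comm]

/-- **The algebraic projection defining the twistor operator.**
With the notation of the decomposition `V ⊗ ΛᵖV ≅ Λ^{p-1}V ⊕ Λ^{p+1}V ⊕ Λ^{p,1}V`
(here `p = q + 1`, `1 ≤ p ≤ n - 1`): for `τ = ∑ i, e i ⊗ τᵢ ∈ V ⊗ ΛᵖV` set
`P(τ) = ∑ i, e i ⊗ (τᵢ − (1/(p+1))·(e i ⌟ w(τ)) − (1/(n−p+1))·(e i ∧ c(τ)))`.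
Then `P(τ) ∈ Λ^{p,1}V = ker w ∩ ker c` and `τ − P(τ) ∈ im j₋ + im j₊`, i.e.
`P` is the projection onto `Λ^{p,1}V` along `im j₋ ⊕ im j₊`. -/
theorem twistor_projection
    {V : Type*} [NormedAddCommGroup V] [InnerProductSpace ℝ V]
    [FiniteDimensional ℝ V]
    {n : ℕ} (e : OrthonormalBasis (Fin n) ℝ V)
    (q : ℕ) (hp : q + 1 ≤ n - 1)
    (Wdg : ∀ k : ℕ, V →ₗ[ℝ] ↥(⋀[ℝ]^k V) →ₗ[ℝ] ↥(⋀[ℝ]^(k+1) V))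
    (hWdg : ∀ (k : ℕ) (v : V) (ω : ⋀[ℝ]^k V),
      ((Wdg k v ω : ⋀[ℝ]^(k+1) V) : ExteriorAlgebra ℝ V) =
        ExteriorAlgebra.ι ℝ v * (ω : ExteriorAlgebra ℝ V))
    (Ctr : ∀ k : ℕ, V →ₗ[ℝ] ↥(⋀[ℝ]^(k+1) V) →ₗ[ℝ] ↥(⋀[ℝ]^k V))
    (hCtr : ∀ (k : ℕ) (v : V) (ω : ⋀[ℝ]^(k+1) V),
      ((Ctr k v ω : ⋀[ℝ]^k V) : ExteriorAlgebra ℝ V) =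
        CliffordAlgebra.contractLeft (Q := (0 : QuadraticForm ℝ V))
          (innerₛₗ ℝ v) (ω : ExteriorAlgebra ℝ V))
    (w : V ⊗[ℝ] ↥(⋀[ℝ]^(q+1) V) →ₗ[ℝ] ↥(⋀[ℝ]^(q+2) V))
    (hw : w = TensorProduct.lift (Wdg (q+1)))
    (c : V ⊗[ℝ] ↥(⋀[ℝ]^(q+1) V) →ₗ[ℝ] ↥(⋀[ℝ]^q V))
    (hc : c = TensorProduct.lift (Ctr q))
    (jminus : ↥(⋀[ℝ]^q V) →ₗ[ℝ] V ⊗[ℝ] ↥(⋀[ℝ]^(q+1) V))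
    (hjminus : jminus =
      ∑ i, (TensorProduct.mk ℝ V ↥(⋀[ℝ]^(q+1) V) (e i)) ∘ₗ (Wdg q (e i)))
    (jplus : ↥(⋀[ℝ]^(q+2) V) →ₗ[ℝ] V ⊗[ℝ] ↥(⋀[ℝ]^(q+1) V))
    (hjplus : jplus =
      ∑ i, (TensorProduct.mk ℝ V ↥(⋀[ℝ]^(q+1) V) (e i)) ∘ₗ (Ctr (q+1) (e i)))
    (τ : V ⊗[ℝ] ↥(⋀[ℝ]^(q+1) V)) (τi : Fin n → ↥(⋀[ℝ]^(q+1) V))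
    (hτ : τ = ∑ i, (e i) ⊗ₜ[ℝ] (τi i))
    (Pτ : V ⊗[ℝ] ↥(⋀[ℝ]^(q+1) V))
    (hPτ : Pτ = ∑ i, (e i) ⊗ₜ[ℝ]
      (τi i
        - (1 / (((q : ℝ) + 1) + 1)) • Ctr (q+1) (e i) (w τ)
        - (1 / ((n : ℝ) - ((q : ℝ) + 1) + 1)) • Wdg q (e i) (c τ))) :
    Pτ ∈ LinearMap.ker w ⊓ LinearMap.ker c ∧
      τ - Pτ ∈ LinearMap.range jminus ⊔ LinearMap.range jplus := by
  classical
  have N : ∀ k (ω : ⋀[ℝ]^(k+1) V), ∑ i, Wdg k (e i) (Ctr k (e i) ω) = ((k : ℝ) + 1) • ω := by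
    intro k ω
    apply Subtype.ext
    have := number_op e (k+1) ω ω.2
    push_cast at this
    simp only [AddSubmonoidClass.coe_finsetSum, hWdg, hCtr, Submodule.coe_smul]
    exact this
  have WW : ∀ k v (ω : ⋀[ℝ]^k V), Wdg (k+1) v (Wdg k v ω) = 0 := by
    intro k v ω
    apply Subtype.ext
    rw [hWdg, hWdg, ← mul_assoc, ExteriorAlgebra.ι_sq_zero, zero_mul]; rfl
  have CC : ∀ k v (ω : ⋀[ℝ]^(k+2) V), Ctr k v (Ctr (k+1) v ω) = 0 := by
    intro k v ω
    apply Subtype.ext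
    rw [hCtr, hCtr]
    exact CliffordAlgebra.contractLeft_contractLeft (Q := (0 : QuadraticForm ℝ V)) _ _
  have CW0 : ∀ k v (ω : ⋀[ℝ]^k V), ((Ctr k v (Wdg k v ω) : ⋀[ℝ]^k V) : ExteriorAlgebra ℝ V) =
      (inner ℝ v v : ℝ) • (ω : ExteriorAlgebra ℝ V) - ExteriorAlgebra.ι ℝ v *
        (CliffordAlgebra.contractLeft (Q := (0 : QuadraticForm ℝ V)) (innerₛₗ ℝ v)
          (ω : ExteriorAlgebra ℝ V) : ExteriorAlgebra ℝ V) := by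
    intro k v ω
    rw [hCtr, hWdg]
    exact CliffordAlgebra.contractLeft_ι_mul (Q := (0 : QuadraticForm ℝ V)) _ v _
  have M : ∀ k (ω : ⋀[ℝ]^k V), ∑ i, Ctr k (e i) (Wdg k (e i) ω) = ((n : ℝ) - k) • ω := by
    intro k ω
    apply Subtype.ext
    simp only [AddSubmonoidClass.coe_finsetSum, CW0, Submodule.coe_smul]
    rw [Finset.sum_sub_distrib, number_op e k ω ω.2, sub_smul]
    simp [Nat.cast_smul_eq_nsmul]
  have hq : ((q : ℝ) + 1) + 1 ≠ 0 := by positivity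
  have hn : (n : ℝ) - ((q : ℝ) + 1) + 1 ≠ 0 := by
    have : q + 1 ≤ n := by omega
    have : (q : ℝ) + 1 ≤ n := by exact_mod_cast this
    intro h; linarith
  have hP : Pτ = τ - (1 / (((q : ℝ) + 1) + 1)) • jplus (w τ)
      - (1 / ((n : ℝ) - ((q : ℝ) + 1) + 1)) • jminus (c τ) := by
    rw [hPτ, hjplus, hjminus]
    simp only [tmul_sub, tmul_smul, Finset.sum_sub_distrib, ← Finset.smul_sum, ← hτ,
      LinearMap.sum_apply, LinearMap.comp_apply, TensorProduct.mk_apply]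
  have wp : ∀ η, w (jplus η) = (((q : ℝ) + 1) + 1) • η := by
    intro η
    rw [hw, hjplus]
    simp only [LinearMap.sum_apply, LinearMap.comp_apply, TensorProduct.mk_apply, map_sum,
      TensorProduct.lift.tmul]
    rw [N]; push_cast; rfl
  have wm : ∀ η, w (jminus η) = 0 := by
    intro η
    rw [hw, hjminus]
    simp only [LinearMap.sum_apply, LinearMap.comp_apply, TensorProduct.mk_apply, map_sum,
      TensorProduct.lift.tmul, WW, Finset.sum_const_zero]
  have cp : ∀ η, c (jplus η) = 0 := by
    intro η
    rw [hc, hjplus]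
    simp only [LinearMap.sum_apply, LinearMap.comp_apply, TensorProduct.mk_apply, map_sum,
      TensorProduct.lift.tmul, CC, Finset.sum_const_zero]
  have cm : ∀ η, c (jminus η) = ((n : ℝ) - ((q : ℝ) + 1) + 1) • η := by
    intro η
    rw [hc, hjminus]
    simp only [LinearMap.sum_apply, LinearMap.comp_apply, TensorProduct.mk_apply, map_sum,
      TensorProduct.lift.tmul]
    rw [M]; congr 1; ring
  refine ⟨⟨?_, ?_⟩, ?_⟩
  · change w Pτ = 0
    rw [hP, map_sub, map_sub, map_smul, map_smul, wp, wm, smul_smul, one_div_mul_cancel hq]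
    simp
  · change c Pτ = 0
    rw [hP, map_sub, map_sub, map_smul, map_smul, cp, cm, smul_smul, one_div_mul_cancel hn]
    simp
  · refine Submodule.mem_sup.2 ⟨_, ⟨(1 / ((n : ℝ) - ((q : ℝ) + 1) + 1)) • c τ, rfl⟩,
      _, ⟨(1 / (((q : ℝ) + 1) + 1)) • w τ, rfl⟩, ?_⟩
    rw [hP, map_smul, map_smul]
    abel
end
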